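/- arXiv:0906.4032 — 2 statements merged into one kernel-verified Lean document; each statement's English description precedes it below -/
import Mathlib

section
/- Under the finite mixture model with C components, data x⁽¹⁾,…,x⁽ⁿ⁾, Dirichlet prior on weights and i.i.d. priors p(θⱼ|β) on component parameters, the marginal likelihood can be written as a sum over set partitions: p(D|α,β) = Σ_{v ∈ 𝒱_{≤C}} p(v|α) · p(D|v,β), where 𝒱_{≤C} is the set of partitions of {1,…,n} into at most C nonempty blocks, p(v|α) = Σ_{c inducing partition v} p(c|α) with p(c|α) = ∫ (∏ᵢ ζ_{cᵢ}) p(ζ|α) dζ, and p(D|v,β) = ∏_{B ∈ v} ∫ [∏_{i ∈ B} p(x⁽ⁱ⁾|θ)] p(θ|β) dθ, assuming all integrands are integrable. -/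
open MeasureTheory Finset

/-- The nonempty fibers of an assignment map `c`. -/
def nonemptyFibers {n C : ℕ} (c : Fin n → Fin C) : Finset (Finset (Fin n)) :=
  ((univ : Finset (Fin C)).image fun j => univ.filter fun i => c i = j).filter
    (fun B => B.Nonempty)

theorem mem_nonemptyFibers {n C : ℕ} {c : Fin n → Fin C} {B : Finset (Fin n)} :
    B ∈ nonemptyFibers c ↔ (∃ j, (univ.filter fun i => c i = j) = B) ∧ B.Nonempty := by
  simp [nonemptyFibers]

theorem card_nonemptyFibers_le {n C : ℕ} (c : Fin n → Fin C) :
    (nonemptyFibers c).card ≤ C :=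
  (card_filter_le _ _).trans (card_image_le.trans (by simp))

/-- The partition of `Fin n` induced by an assignment map `c`. -/
def fiberPartition {n C : ℕ} (c : Fin n → Fin C) :
    Finpartition (univ : Finset (Fin n)) where
  parts := nonemptyFibers c
  supIndep := by
    rw [Finset.supIndep_iff_pairwiseDisjoint]
    intro A hA B hB hAB
    obtain ⟨⟨j, rfl⟩, -⟩ := mem_nonemptyFibers.1 hA
    obtain ⟨⟨k, rfl⟩, -⟩ := mem_nonemptyFibers.1 hB
    refine Finset.disjoint_left.2 fun i hi hk => hAB ?_
    simp only [mem_filter, mem_univ, true_and, id] at hi hk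
    rw [← hi, ← hk]
  sup_parts := by
    refine eq_univ_of_forall fun i => Finset.mem_sup.2 ⟨univ.filter fun i' => c i' = c i, ?_, ?_⟩
    · exact mem_nonemptyFibers.2 ⟨⟨c i, rfl⟩, ⟨i, by simp⟩⟩
    · simp
  bot_notMem := fun h => by simpa using (mem_nonemptyFibers.1 h).2

/-- A product over all fibers may omit the empty ones when these contribute `1`. -/
theorem prod_nonemptyFibers {M : Type*} [CommMonoid M] {n C : ℕ} (c : Fin n → Fin C)
    (F : Finset (Fin n) → M) (hF : F ∅ = 1) :
    ∏ B ∈ nonemptyFibers c, F B = ∏ j, F (univ.filter fun i => c i = j) := by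
  rw [nonemptyFibers, filter_image, prod_image]
  · refine prod_filter_of_ne fun j _ hj => ?_
    rw [nonempty_iff_ne_empty]
    intro h
    exact hj (by rw [h, hF])
  · intro j hj k _ hjk
    dsimp only at hjk
    obtain ⟨i, hi⟩ := (mem_filter.1 hj).2
    have hk : i ∈ univ.filter fun i => c i = k := hjk ▸ hi
    exact (mem_filter.1 hi).2.symm.trans (mem_filter.1 hk).2

/-- The mixture likelihood times the parameter prior, expanded over assignment maps. -/
theorem prod_sum_mixture_eq {n C : ℕ} {Θ : Type*} (q : Fin n → Θ → ℝ) (r : Θ → ℝ)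
    (ζ : Fin C → ℝ) (θ : Fin C → Θ) :
    (∏ i, ∑ j, ζ j * q i (θ j)) * ∏ j, r (θ j)
      = ∑ c : Fin n → Fin C, (∏ i, ζ (c i)) *
          ∏ j, (∏ i ∈ univ.filter (fun i => c i = j), q i (θ j)) * r (θ j) := by
  rw [prod_univ_sum, Fintype.piFinset_univ, sum_mul]
  refine sum_congr rfl fun c _ => ?_
  rw [prod_mul_distrib, prod_mul_distrib, mul_assoc]
  congr 2
  rw [← prod_fiberwise univ c fun i => q i (θ (c i))]
  refine prod_congr rfl fun j _ => prod_congr rfl fun i hi => ?_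
  rw [(mem_filter.1 hi).2]

/-- The marginal likelihood of a finite mixture model with `C` components can
be written as a sum over set partitions `v` of `{1,…,n}` into at most `C`
nonempty blocks: `p(D|α,β) = ∑_{v ∈ 𝒱_{≤C}} p(v|α) p(D|v,β)`, where
`p(v|α) = ∑_{c inducing v} p(c|α)` with `p(c|α) = ∫ (∏ᵢ ζ_{cᵢ}) p(ζ|α) dζ`,
and `p(D|v,β) = ∏_{B ∈ v} ∫ (∏_{i ∈ B} p(x⁽ⁱ⁾|θ)) p(θ|β) dθ`.
An assignment `c : {1,…,n} → {1,…,C}` induces the partition whose blocks are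
the nonempty fibers of `c`. -/
theorem statement_9 {𝒳 Θ : Type*} [MeasurableSpace Θ]
    (C n : ℕ) (x : Fin n → 𝒳) (p : 𝒳 → Θ → ℝ)
    (μΘ : Measure Θ) [SigmaFinite μΘ]
    (pθ : Θ → ℝ) (hpθ0 : ∀ θ, 0 ≤ pθ θ) (hpθ1 : ∫ θ, pθ θ ∂μΘ = 1)
    (ρ : Measure (Fin C → ℝ)) [IsProbabilityMeasure ρ]
    (hρ : ∀ᵐ ζ ∂ρ, (∀ j, 0 ≤ ζ j) ∧ ∑ j, ζ j = 1)
    (hint : Integrable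
      (fun φ : (Fin C → ℝ) × (Fin C → Θ) =>
        (∏ i, ∑ j, φ.1 j * p (x i) (φ.2 j)) * ∏ j, pθ (φ.2 j))
      (ρ.prod (Measure.pi fun _ : Fin C => μΘ)))
    (hintζ : ∀ c : Fin n → Fin C, Integrable (fun ζ : Fin C → ℝ => ∏ i, ζ (c i)) ρ)
    (hintθ : ∀ s : Finset (Fin n),
      Integrable (fun θ : Θ => (∏ i ∈ s, p (x i) θ) * pθ θ) μΘ) :
    (∫ φ : (Fin C → ℝ) × (Fin C → Θ),
        (∏ i, ∑ j, φ.1 j * p (x i) (φ.2 j)) * ∏ j, pθ (φ.2 j)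
        ∂(ρ.prod (Measure.pi fun _ : Fin C => μΘ)))
      = ∑ v ∈ univ.filter
            (fun v : Finpartition (univ : Finset (Fin n)) => v.parts.card ≤ C),
          (∑ c ∈ univ.filter (fun c : Fin n → Fin C =>
              ((univ : Finset (Fin C)).image fun j => univ.filter fun i => c i = j).filter
                  (fun B => B.Nonempty)
                = v.parts),
            ∫ ζ, (∏ i, ζ (c i)) ∂ρ) *
            ∏ B ∈ v.parts, ∫ θ, (∏ i ∈ B, p (x i) θ) * pθ θ ∂μΘ := by
  simp_rw [prod_sum_mixture_eq fun i => p (x i)]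
  have hterm : ∀ c : Fin n → Fin C, Integrable
      (fun φ : (Fin C → ℝ) × (Fin C → Θ) => (∏ i, φ.1 (c i)) *
        ∏ j, (∏ i ∈ univ.filter (fun i => c i = j), p (x i) (φ.2 j)) * pθ (φ.2 j))
      (ρ.prod (Measure.pi fun _ : Fin C => μΘ)) := fun c =>
    (hintζ c).mul_prod (Integrable.fintype_prod (f := fun (j : Fin C) (θ : Θ) =>
      (∏ i ∈ univ.filter (fun i => c i = j), p (x i) θ) * pθ θ) fun j => hintθ _)
  rw [integral_finsetSum _ fun c _ => hterm c,
    ← sum_fiberwise_of_maps_to (g := fiberPartition)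
      (t := univ.filter fun v : Finpartition (univ : Finset (Fin n)) => v.parts.card ≤ C)
      fun c _ => mem_filter.2 ⟨mem_univ _, card_nonemptyFibers_le c⟩]
  refine sum_congr rfl fun v _ => ?_
  rw [sum_mul]
  refine sum_congr (filter_congr fun c _ => Finpartition.ext_iff) fun c hc => ?_
  have hv : nonemptyFibers c = v.parts := (mem_filter.1 hc).2
  rw [← hv, prod_nonemptyFibers c _ (by simpa using hpθ1),
    integral_prod_mul (fun ζ : Fin C → ℝ => ∏ i, ζ (c i)) fun θ : Fin C → Θ =>
      ∏ j, (∏ i ∈ univ.filter (fun i => c i = j), p (x i) (θ j)) * pθ (θ j),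
    integral_fintype_prod_eq_prod (fun (j : Fin C) (θ : Θ) =>
      (∏ i ∈ univ.filter (fun i => c i = j), p (x i) θ) * pθ θ)]
end

section
/- Fix α > 0, an integer n ≥ 1, and a partition of {1,…,n} into k nonempty blocks of sizes n₁, …, n_k (so Σⱼ nⱼ = n). For C ≥ k, the number of assignment maps c : {1,…,n} → {1,…,C} inducing this partition is C!/(C−k)!, and each has probability p(c|α) = [Γ(α)/Γ(α+n)] ∏ⱼ₌₁^k Γ(α/C + nⱼ)/Γ(α/C) under the symmetric Dirichlet prior. The total probability of the partition therefore satisfies lim_{C→∞} [C!/(C−k)!] · [Γ(α)/Γ(α+n)] · ∏ⱼ₌₁^k Γ(α/C + nⱼ)/Γ(α/C) = α^k · [Γ(α)/Γ(α+n)] · ∏ⱼ₌₁^k (nⱼ − 1)!. -/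
open Finset

/-- The nonempty fibers of `c` are the parts of `P` exactly when the fiber through each point is
its part. -/
theorem Finpartition.fibers_eq_parts_iff {ι κ : Type*} [Fintype ι] [DecidableEq ι] [Fintype κ]
    [DecidableEq κ] (P : Finpartition (univ : Finset ι)) (c : ι → κ) :
    ((univ : Finset κ).image fun j => univ.filter fun i => c i = j).filter
        (fun B => B.Nonempty) = P.parts ↔
      ∀ i i', c i' = c i ↔ i' ∈ P.part i := by
  constructor
  · intro h i i'
    have hmem : (univ.filter fun i' => c i' = c i) ∈ P.parts := by
      rw [← h, mem_filter]
      exact ⟨mem_image_of_mem _ (mem_univ _), i, by simp⟩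
    rw [P.part_eq_of_mem hmem (by simp)]
    simp
  · intro h
    have hfib : ∀ i, (univ.filter fun i' => c i' = c i) = P.part i := fun i => by
      ext i'
      simp [h]
    ext B
    simp only [mem_filter, mem_image, mem_univ, true_and]
    constructor
    · rintro ⟨⟨j, rfl⟩, i, hi⟩
      obtain rfl : c i = j := by simpa using hi
      rw [hfib]
      exact P.part_mem.2 (mem_univ i)
    · intro hB
      obtain ⟨i, hi⟩ := P.nonempty_of_mem_parts hB
      exact ⟨⟨c i, (hfib i).trans (P.part_eq_of_mem hB hi)⟩, i, hi⟩

theorem Finpartition.card_filter_fibers_eq_parts {ι κ : Type*} [Fintype ι] [DecidableEq ι]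
    [Fintype κ] [DecidableEq κ] (P : Finpartition (univ : Finset ι)) :
    (univ.filter (fun c : ι → κ =>
        ((univ : Finset κ).image fun j => univ.filter fun i => c i = j).filter
            (fun B => B.Nonempty) = P.parts)).card =
      (Fintype.card κ).descFactorial P.parts.card := by
  have hpart (i : ι) : P.part i ∈ P.parts := P.part_mem.2 (mem_univ i)
  have hiff (i i' : ι) : i' ∈ P.part i ↔ P.part i' = P.part i :=
    P.mem_part_iff_part_eq_part (mem_univ _) (mem_univ _)
  rw [← Fintype.card_coe P.parts, ← Fintype.card_embedding_eq, ← card_univ, eq_comm]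
  refine card_bij (fun f _ i => f ⟨P.part i, hpart i⟩) ?_ ?_ ?_
  · intro f _
    simp [P.fibers_eq_parts_iff, hiff]
  · intro f _ g _ hfg
    ext ⟨B, hB⟩
    obtain ⟨i, hi⟩ := P.nonempty_of_mem_parts hB
    obtain rfl := P.part_eq_of_mem hB hi
    exact congrFun hfg i
  · intro c hc
    simp only [mem_filter, mem_univ, true_and, P.fibers_eq_parts_iff] at hc
    choose r hr using fun B : P.parts => P.nonempty_of_mem_parts B.2
    have hr' (B : P.parts) : P.part (r B) = B := P.part_eq_of_mem B.2 (hr B)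
    refine ⟨⟨fun B => c (r B), fun B B' h => ?_⟩, mem_univ _, ?_⟩
    · have := (hiff _ _).1 ((hc _ _).1 h)
      rw [hr', hr'] at this
      exact Subtype.ext this
    · funext i
      exact (hc i _).2 (hr ⟨P.part i, hpart i⟩)

theorem tendsto_descFactorial_div_pow (k : ℕ) :
    Filter.Tendsto (fun C : ℕ => (C.descFactorial k : ℝ) / (C : ℝ) ^ k) Filter.atTop (nhds 1) := by
  refine (Asymptotics.isEquivalent_iff_tendsto_one ?_).1 (isEquivalent_descFactorial k)
  filter_upwards [Filter.eventually_gt_atTop 0] with C hC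
  positivity

theorem tendsto_natCast_mul_Gamma_div_Gamma {α : ℝ} (hα : 0 < α) {m : ℕ} (hm : 0 < m) :
    Filter.Tendsto (fun C : ℕ => (C : ℝ) * Real.Gamma (α / C + m) / Real.Gamma (α / C))
      Filter.atTop (nhds (α * ((m - 1).factorial : ℝ))) := by
  have hlim {x : ℝ} (hx : 0 < x) : Filter.Tendsto (fun C : ℕ => Real.Gamma (α / C + x))
      Filter.atTop (nhds (Real.Gamma x)) := by
    have hcont : ContinuousAt Real.Gamma x := (Real.differentiableAt_Gamma fun j =>
      ((neg_nonpos.2 j.cast_nonneg).trans_lt hx).ne').continuousAt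
    refine hcont.tendsto.comp ?_
    simpa using (tendsto_const_div_atTop_nhds_zero_nat α).add_const x
  have hGm : Real.Gamma m = (m - 1).factorial := by
    obtain ⟨l, rfl⟩ := Nat.exists_eq_add_of_lt hm
    simpa using Real.Gamma_nat_eq_factorial l
  have h := ((hlim (Nat.cast_pos.2 hm)).const_mul α).div (hlim one_pos) (by simp)
  rw [hGm, Real.Gamma_one, div_one] at h
  refine h.congr' ?_
  filter_upwards [Filter.eventually_gt_atTop 0] with C hC
  have hx : 0 < α / C := by positivity
  have hΓ := (Real.Gamma_pos_of_pos hx).ne'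
  simp only [Pi.div_apply]
  rw [Real.Gamma_add_one hx.ne']
  field_simp

/-- Fix a partition `v` of `{1,…,n}` into `k` nonempty blocks. For `C ≥ k`, the
number of assignment maps `c : {1,…,n} → {1,…,C}` inducing `v` is
`C!/(C−k)!`, and each has probability
`p(c|α) = [Γ(α)/Γ(α+n)] ∏_B Γ(α/C + |B|)/Γ(α/C)` under the symmetric
Dirichlet prior.  The total probability of the partition satisfies
`lim_{C→∞} [C!/(C−k)!]·[Γ(α)/Γ(α+n)]·∏_B Γ(α/C+|B|)/Γ(α/C)
  = α^k·[Γ(α)/Γ(α+n)]·∏_B (|B|−1)!`. -/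
theorem statement_10 (α : ℝ) (hα : 0 < α) (n k : ℕ) (hn : 1 ≤ n)
    (v : Finpartition (univ : Finset (Fin n))) (hk : v.parts.card = k) :
    (∀ C : ℕ, k ≤ C →
      (univ.filter (fun c : Fin n → Fin C =>
          ((univ : Finset (Fin C)).image fun j => univ.filter fun i => c i = j).filter
              (fun B => B.Nonempty)
            = v.parts)).card
        = C.factorial / (C - k).factorial) ∧
    Filter.Tendsto
      (fun C : ℕ =>
        ((C.factorial : ℝ) / ((C - k).factorial : ℝ)) *
          (Real.Gamma α / Real.Gamma (α + n)) *
          ∏ B ∈ v.parts, Real.Gamma (α / C + B.card) / Real.Gamma (α / C))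
      Filter.atTop
      (nhds (α ^ k * (Real.Gamma α / Real.Gamma (α + n)) *
        ∏ B ∈ v.parts, ((B.card - 1).factorial : ℝ))) := by
  subst hk
  refine ⟨fun C hC => ?_, ?_⟩
  · rw [v.card_filter_fibers_eq_parts, Fintype.card_fin, Nat.descFactorial_eq_div hC]
  · have hlim := ((tendsto_descFactorial_div_pow v.parts.card).mul_const
      (Real.Gamma α / Real.Gamma (α + n))).mul
      (tendsto_finsetProd v.parts fun B hB =>
        tendsto_natCast_mul_Gamma_div_Gamma hα (v.nonempty_of_mem_parts hB).card_pos)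
    rw [prod_mul_distrib, prod_const, one_mul, mul_left_comm, ← mul_assoc] at hlim
    refine hlim.congr' ?_
    filter_upwards [Filter.eventually_ge_atTop v.parts.card, Filter.eventually_gt_atTop 0]
      with C hC hC0
    have hfac : ((C.factorial : ℝ) / ((C - v.parts.card).factorial : ℝ)) =
        C.descFactorial v.parts.card := by
      rw [div_eq_iff (by positivity), mul_comm]
      exact_mod_cast (Nat.factorial_mul_descFactorial hC).symm
    have hC' : (C : ℝ) ≠ 0 := by positivity
    simp only [mul_div_assoc, prod_mul_distrib, prod_const]
    rw [← mul_div_assoc, hfac]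
    field_simp
end
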